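/- Let X₁,…,X_{2N} be independent uniform random variables on [0,1] with order statistics X₍₁₎ ≤ … ≤ X₍₂N₎. Then for every real γ with N + γ > 0 and every l ∈ {1,…,N}, E[ (X₍l+N₎ − X₍l₎)^γ ] = Γ(2N+1)Γ(N+γ) / (Γ(N)Γ(2N+γ+1)). In particular, for p < 0 with N > −p, the average optimal cost per edge of the random Euclidean matching problem of 2N uniform points on [0,1] with cost z^p equals Γ(2N+1)Γ(N+p)/(Γ(N)Γ(2N+p+1)). -/

import Mathlib

open MeasureTheory

/-- The uniform probability measure on `[0,1]`. -/
noncomputable def unif : Measure ℝ := volume.restrict (Set.Icc 0 1)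

/-- The law of `n` independent uniform points on `[0,1]`. -/
noncomputable def unifPi (n : ℕ) : Measure (Fin n → ℝ) :=
  Measure.pi fun _ => unif

/-- The increasing rearrangement (order statistics) of a tuple. -/
noncomputable def sortedTuple {n : ℕ} (ω : Fin n → ℝ) (i : Fin n) : ℝ :=
  ω (Tuple.sort ω i)

open Set
open scoped ENNReal

theorem lintegral_Ioc_pow_div_factorial (m : ℕ) {u : ℝ} (hu : 0 ≤ u) :
    ∫⁻ x in Ioc 0 u, ENNReal.ofReal (x ^ m / m.factorial) =
      ENNReal.ofReal (u ^ (m + 1) / (m + 1).factorial) := by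
  rw [← ofReal_integral_eq_lintegral_ofReal]
  · rw [← intervalIntegral.integral_of_le hu, intervalIntegral.integral_div, integral_pow,
      Nat.factorial_succ]
    congr 1
    push_cast
    field_simp
    simp
  · exact (Continuous.integrableOn_Icc (by fun_prop)).mono_set Ioc_subset_Icc_self
  · refine ae_restrict_of_forall_mem measurableSet_Ioc fun x hx => ?_
    have := hx.1.le
    positivity

theorem lintegral_Ioi_lintegral_Ioi_add {F c : ℝ → ℝ≥0∞} (hF : Measurable F)
    (hc : Measurable c) :
    ∫⁻ s in Ioi (0 : ℝ), ∫⁻ x in Ioi (0 : ℝ), F (s + x) * c x =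
      ∫⁻ u in Ioi (0 : ℝ), F u * ∫⁻ x in Ioc 0 u, c x := by
  have shift (x : ℝ) : ∫⁻ s in Ioi (0 : ℝ), F (s + x) * c x = ∫⁻ u in Ioi x, F u * c x := by
    rw [← (measurePreserving_add_right volume x).setLIntegral_comp_preimage_emb
      (MeasurableEquiv.addRight x).measurableEmbedding (fun u => F u * c x) (Ioi x)]
    simp
  rw [lintegral_lintegral_swap (by fun_prop)]
  simp_rw [shift]
  calc ∫⁻ x in Ioi (0 : ℝ), ∫⁻ u in Ioi x, F u * c x
      = ∫⁻ x in Ioi (0 : ℝ), ∫⁻ u in Ioi (0 : ℝ),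
          {z : ℝ × ℝ | z.1 < z.2}.indicator (fun z => F z.2 * c z.1) (x, u) := by
        refine setLIntegral_congr_fun measurableSet_Ioi fun x hx => ?_
        have : ∀ u, {z : ℝ × ℝ | z.1 < z.2}.indicator (fun z => F z.2 * c z.1) (x, u) =
            (Ioi x).indicator (fun u => F u * c x) u := fun u => by
          simp [indicator_apply]
        simp_rw [this]
        rw [setLIntegral_indicator measurableSet_Ioi, Ioi_inter_Ioi, max_eq_left (le_of_lt hx)]
    _ = ∫⁻ u in Ioi (0 : ℝ), ∫⁻ x in Ioi (0 : ℝ),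
          {z : ℝ × ℝ | z.1 < z.2}.indicator (fun z => F z.2 * c z.1) (x, u) := by
        refine lintegral_lintegral_swap (Measurable.aemeasurable ?_)
        exact Measurable.indicator (by fun_prop) (measurableSet_lt measurable_fst measurable_snd)
    _ = ∫⁻ u in Ioi (0 : ℝ), F u * ∫⁻ x in Ioc 0 u, c x := by
        refine setLIntegral_congr_fun measurableSet_Ioi fun u hu => ?_
        have : ∀ x, {z : ℝ × ℝ | z.1 < z.2}.indicator (fun z => F z.2 * c z.1) (x, u) =
            (Iio u).indicator (fun x => F u * c x) x := fun x => by
          simp [indicator_apply]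
        simp_rw [this]
        rw [setLIntegral_indicator measurableSet_Iio, inter_comm, Ioi_inter_Iio,
          lintegral_const_mul _ hc, setLIntegral_congr Ioo_ae_eq_Ioc]

theorem lintegral_pi_Ioi_fin_sum (m : ℕ) {F : ℝ → ℝ≥0∞} (hF : Measurable F) :
    ∫⁻ s, F (∑ i, s i) ∂(Measure.pi fun _ : Fin (m + 1) => volume.restrict (Ioi (0 : ℝ))) =
      ∫⁻ x in Ioi (0 : ℝ), F x * ENNReal.ofReal (x ^ m / m.factorial) := by
  induction m generalizing F with
  | zero =>
    have h := ((measurePreserving_funUnique (volume.restrict (Ioi (0 : ℝ)))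
      (Fin 1)).lintegral_map_equiv F).symm
    simp only [pow_zero, Nat.factorial_zero, Nat.cast_one, div_one, ENNReal.ofReal_one, mul_one]
    convert h using 2
    · congr!
    · simp
  | succ m ih =>
    rw [((measurePreserving_piFinSuccAbove
      (fun _ : Fin (m + 2) => volume.restrict (Ioi (0 : ℝ))) 0).symm).lintegral_map_equiv,
      lintegral_prod]
    · simp only [Fin.sum_univ_succ (n := m + 1)]
      simp only [MeasurableEquiv.piFinSuccAbove_symm_apply, Fin.insertNthEquiv_zero,
        Fin.consEquiv_apply, Fin.cons_zero, Fin.cons_succ]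
      calc _ = ∫⁻ s in Ioi (0 : ℝ), ∫⁻ x in Ioi (0 : ℝ),
            F (s + x) * ENNReal.ofReal (x ^ m / m.factorial) :=
          lintegral_congr fun s => ih (F := fun x => F (s + x)) (by fun_prop)
        _ = _ := by
          rw [lintegral_Ioi_lintegral_Ioi_add hF (by fun_prop)]
          refine setLIntegral_congr_fun measurableSet_Ioi fun u hu => ?_
          simp only [lintegral_Ioc_pow_div_factorial m (le_of_lt hu)]
    · refine Measurable.aemeasurable ?_
      fun_prop

theorem lintegral_pi_Ioi_sum {ι : Type*} [Fintype ι] {m : ℕ} (hι : Fintype.card ι = m + 1)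
    {F : ℝ → ℝ≥0∞} (hF : Measurable F) :
    ∫⁻ s, F (∑ i, s i) ∂(Measure.pi fun _ : ι => volume.restrict (Ioi (0 : ℝ))) =
      ∫⁻ x in Ioi (0 : ℝ), F x * ENNReal.ofReal (x ^ m / m.factorial) := by
  let e : Fin (m + 1) ≃ ι := (Fintype.equivFinOfCardEq hι).symm
  rw [← lintegral_pi_Ioi_fin_sum m hF, (measurePreserving_arrowCongr'
    (fun _ : Fin (m + 1) => volume.restrict (Ioi (0 : ℝ))) (fun _ : ι => volume.restrict (Ioi 0)) e
    (MeasurableEquiv.refl ℝ) fun _ => MeasurePreserving.id _).lintegral_map_equiv]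
  refine lintegral_congr fun s => ?_
  rw [← e.sum_comp]
  exact congrArg F (Finset.sum_congr rfl fun i _ => congrArg s (e.symm_apply_apply i))

theorem lintegral_pi_Ioi_sum_subtype {ι : Type*} [Fintype ι] (p : ι → Prop) [DecidablePred p]
    {k m : ℕ} (hk : Fintype.card {i // p i} = k + 1) (hm : Fintype.card {i // ¬ p i} = m + 1)
    {H : ℝ → ℝ → ℝ≥0∞} (hH : Measurable (Function.uncurry H)) :
    ∫⁻ s, H (∑ i : {i // p i}, s i) (∑ i : {i // ¬ p i}, s i)
        ∂(Measure.pi fun _ : ι => volume.restrict (Ioi (0 : ℝ))) =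
      ∫⁻ x in Ioi (0 : ℝ), (∫⁻ y in Ioi (0 : ℝ), H x y * ENNReal.ofReal (y ^ m / m.factorial)) *
        ENNReal.ofReal (x ^ k / k.factorial) := by
  calc _ = ∫⁻ z : ({i // p i} → ℝ) × ({i // ¬ p i} → ℝ), H (∑ i, z.1 i) (∑ i, z.2 i)
        ∂((Measure.pi fun _ => volume.restrict (Ioi (0 : ℝ))).prod
          (Measure.pi fun _ => volume.restrict (Ioi (0 : ℝ)))) := by
        rw [(measurePreserving_piEquivPiSubtypeProd
          (fun _ : ι => volume.restrict (Ioi (0 : ℝ))) p).lintegral_map_equiv]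
        rfl
    _ = _ := by
        rw [lintegral_prod _ (Measurable.aemeasurable (by fun_prop))]
        have hx (x : ℝ) : Measurable (H x) := by fun_prop
        simp_rw [lintegral_pi_Ioi_sum hm (hx _)]
        exact lintegral_pi_Ioi_sum hk (F := fun x => ∫⁻ y in Ioi (0 : ℝ),
          H x y * ENNReal.ofReal (y ^ m / m.factorial))
          (Measurable.lintegral_prod_right (by fun_prop))

theorem lintegral_Ioo_rpow_mul_one_sub_rpow {α β : ℝ} (hα : 0 < α) (hβ : 0 < β) :
    ∫⁻ x in Ioo (0 : ℝ) 1, ENNReal.ofReal (x ^ (α - 1) * (1 - x) ^ (β - 1)) =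
      ENNReal.ofReal (Real.Gamma α * Real.Gamma β / Real.Gamma (α + β)) := by
  have hB := ProbabilityTheory.beta_pos hα hβ
  have h := ProbabilityTheory.lintegral_betaPDF_eq_one hα hβ
  simp_rw [ProbabilityTheory.lintegral_betaPDF, mul_assoc,
    ENNReal.ofReal_mul (one_div_nonneg.2 hB.le)] at h
  rw [lintegral_const_mul _ (by fun_prop), one_div, ENNReal.ofReal_inv_of_pos hB] at h
  change _ = ENNReal.ofReal (ProbabilityTheory.beta α β)
  calc _ = ENNReal.ofReal (ProbabilityTheory.beta α β) *
        ((ENNReal.ofReal (ProbabilityTheory.beta α β))⁻¹ *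
        ∫⁻ x in Ioo (0 : ℝ) 1, ENNReal.ofReal (x ^ (α - 1) * (1 - x) ^ (β - 1))) := by
        rw [ENNReal.mul_inv_cancel_left (by simpa using hB) (by simp)]
    _ = _ := by rw [h, mul_one]

theorem lintegral_simplex_rpow_sum (k m : ℕ) {γ : ℝ} (hγ : 0 < k + 1 + γ) :
    ∫⁻ x in Ioi (0 : ℝ), (∫⁻ y in Ioi (0 : ℝ),
        (if x + y ≤ 1 then ENNReal.ofReal (x ^ γ) else 0) *
          ENNReal.ofReal (y ^ m / m.factorial)) * ENNReal.ofReal (x ^ k / k.factorial) =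
      ENNReal.ofReal (Real.Gamma (k + 1 + γ) /
        (Real.Gamma (k + 1) * Real.Gamma (k + m + 2 + γ + 1))) := by
  have inner (x : ℝ) : ∫⁻ y in Ioi (0 : ℝ), (if x + y ≤ 1 then ENNReal.ofReal (x ^ γ) else 0) *
      ENNReal.ofReal (y ^ m / m.factorial) =
      ENNReal.ofReal (x ^ γ) * ∫⁻ y in Ioc 0 (1 - x), ENNReal.ofReal (y ^ m / m.factorial) := by
    have (y : ℝ) : (if x + y ≤ 1 then ENNReal.ofReal (x ^ γ) else 0) *
        ENNReal.ofReal (y ^ m / m.factorial) = (Iic (1 - x)).indicator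
          (fun y => ENNReal.ofReal (x ^ γ) * ENNReal.ofReal (y ^ m / m.factorial)) y := by
      simp [indicator_apply, le_sub_iff_add_le', ite_mul]
    simp_rw [this]
    rw [setLIntegral_indicator measurableSet_Iic, inter_comm, Ioi_inter_Iic,
      lintegral_const_mul _ (by fun_prop)]
  simp_rw [inner]
  have hk : (0 : ℝ) < k.factorial := by positivity
  have hm : (0 : ℝ) < (m + 1).factorial := by positivity
  calc _ = ∫⁻ x in Ioi (0 : ℝ), (Iio (1 : ℝ)).indicator (fun x =>
        ENNReal.ofReal (1 / (k.factorial * (m + 1).factorial)) *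
        ENNReal.ofReal (x ^ ((k + 1 + γ) - 1) * (1 - x) ^ (((m : ℝ) + 2) - 1))) x := by
        refine setLIntegral_congr_fun measurableSet_Ioi fun x (hx : 0 < x) => ?_
        by_cases h : x < 1
        · have h1 : 0 < 1 - x := by linarith
          simp only [lintegral_Ioc_pow_div_factorial m h1.le]
          rw [indicator_of_mem (by exact h), ← ENNReal.ofReal_mul (by positivity),
            ← ENNReal.ofReal_mul (by positivity), ← ENNReal.ofReal_mul (by positivity)]
          congr 1
          rw [show ((k : ℝ) + 1 + γ) - 1 = γ + k by ring,
            show ((m : ℝ) + 2) - 1 = ((m + 1 : ℕ) : ℝ) by push_cast; ring,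
            Real.rpow_add hx, Real.rpow_natCast, Real.rpow_natCast]
          field_simp
        · rw [indicator_of_notMem (by exact h), Ioc_eq_empty (by linarith)]
          simp
    _ = _ := by
        rw [setLIntegral_indicator measurableSet_Iio, inter_comm, Ioi_inter_Iio,
          lintegral_const_mul _ (by fun_prop),
          lintegral_Ioo_rpow_mul_one_sub_rpow hγ (by positivity),
          ← ENNReal.ofReal_mul (by positivity), Real.Gamma_nat_eq_factorial,
          show ((m : ℝ) + 2) = ((m + 1 : ℕ) : ℝ) + 1 by push_cast; ring,
          Real.Gamma_nat_eq_factorial]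
        congr 1
        rw [show (k : ℝ) + 1 + γ + (((m + 1 : ℕ) : ℝ) + 1) = k + m + 2 + γ + 1 by
          push_cast; ring]
        field_simp

theorem ae_injective_volume_pi (ι : Type*) [Fintype ι] :
    ∀ᵐ ω : ι → ℝ, Function.Injective ω := by
  classical
  have h : ∀ i j : ι, i ≠ j → ∀ᵐ ω : ι → ℝ, ω i ≠ ω j := fun i j hij => by
    have := Measure.addHaar_submodule (volume : Measure (ι → ℝ))
      (LinearMap.ker (LinearMap.proj (R := ℝ) (φ := fun _ : ι => ℝ) i - LinearMap.proj j))
      fun htop => by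
        have hmem : (Pi.single i 1 : ι → ℝ) ∈ LinearMap.ker
            (LinearMap.proj (R := ℝ) (φ := fun _ : ι => ℝ) i - LinearMap.proj j) :=
          htop ▸ Submodule.mem_top
        simp [hij.symm] at hmem
    rw [ae_iff]
    convert this using 2
    ext ω
    simp [sub_eq_zero]
  have h' : ∀ᵐ ω : ι → ℝ, ∀ i j : ι, i ≠ j → ω i ≠ ω j := by
    simp only [ae_all_iff]
    exact h
  filter_upwards [h'] with ω hω i j hij
  by_contra hne
  exact hω i j hne hij

theorem apply_sortedTuple_eq_sum_indicator {n : ℕ} {β : Type*} [AddCommMonoid β]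
    (h : (Fin n → ℝ) → β) {ω : Fin n → ℝ} (hω : Function.Injective ω) :
    h (sortedTuple ω) =
      ∑ σ : Equiv.Perm (Fin n), {x : Fin n → ℝ | StrictMono x}.indicator h (ω ∘ σ) := by
  have hsort : StrictMono (ω ∘ Tuple.sort ω) :=
    (Tuple.monotone_sort ω).strictMono_of_injective (hω.comp (Tuple.sort ω).injective)
  rw [Finset.sum_eq_single (Tuple.sort ω)]
  · rw [indicator_of_mem (by exact hsort)]
    rfl
  · intro σ _ hσ
    refine indicator_of_notMem (fun hmono : StrictMono (ω ∘ σ) => hσ ?_) _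
    have := Tuple.comp_sort_eq_comp_iff_monotone.2 hmono.monotone
    exact Equiv.ext fun i => hω (congrFun this i)
  · simp

theorem unifPi_eq_restrict (n : ℕ) :
    unifPi n = volume.restrict (univ.pi fun _ : Fin n => Ioc (0 : ℝ) 1) := by
  rw [volume_pi, Measure.restrict_pi_pi, unifPi, unif, Measure.restrict_congr_set Ioc_ae_eq_Icc]

theorem ae_injective_unifPi (n : ℕ) : ∀ᵐ ω ∂unifPi n, Function.Injective ω := by
  rw [unifPi_eq_restrict]
  exact ae_restrict_of_ae (ae_injective_volume_pi _)

theorem measurePreserving_comp_perm_unifPi {n : ℕ} (σ : Equiv.Perm (Fin n)) :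
    MeasurePreserving (fun ω : Fin n → ℝ => ω ∘ σ) (unifPi n) (unifPi n) := by
  have : SigmaFinite unif := by unfold unif; infer_instance
  exact measurePreserving_arrowCongr' (fun _ => unif) (fun _ => unif) σ.symm
    (MeasurableEquiv.refl ℝ) fun _ => MeasurePreserving.id _

theorem measurableSet_strictMono (n : ℕ) : MeasurableSet {x : Fin n → ℝ | StrictMono x} := by
  simp only [StrictMono, ofPred_forall]
  refine .iInter fun i => .iInter fun j => .iInter fun _ => ?_
  exact measurableSet_lt (by fun_prop) (by fun_prop)

theorem lintegral_sortedTuple {n : ℕ} {h : (Fin n → ℝ) → ℝ≥0∞} (hh : Measurable h) :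
    ∫⁻ ω, h (sortedTuple ω) ∂unifPi n =
      n.factorial * ∫⁻ ω, {x : Fin n → ℝ | StrictMono x}.indicator h ω ∂unifPi n := by
  have hm := hh.indicator (measurableSet_strictMono n)
  rw [lintegral_congr_ae ((ae_injective_unifPi n).mono fun ω hω =>
    apply_sortedTuple_eq_sum_indicator h hω), lintegral_finsetSum]
  · simp_rw [(measurePreserving_comp_perm_unifPi _).lintegral_comp hm]
    simp [Fintype.card_perm]
  · exact fun σ _ => hm.comp (measurePreserving_comp_perm_unifPi σ).measurable

theorem aemeasurable_apply_sortedTuple {n : ℕ} {h : (Fin n → ℝ) → ℝ} (hh : Measurable h) :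
    AEMeasurable (fun ω => h (sortedTuple ω)) (unifPi n) := by
  refine AEMeasurable.congr (Measurable.aemeasurable ?_)
    ((ae_injective_unifPi n).mono fun ω hω => (apply_sortedTuple_eq_sum_indicator h hω).symm)
  exact Finset.measurable_sum _ fun σ _ => (hh.indicator (measurableSet_strictMono n)).comp
    (measurePreserving_comp_perm_unifPi σ).measurable

theorem measurePreserving_partialSums (n : ℕ) :
    MeasurePreserving (fun (s : Fin n → ℝ) (i : Fin n) => ∑ j ∈ Finset.Iic i, s j) := by
  let M : Matrix (Fin n) (Fin n) ℝ := fun i j => if j ≤ i then 1 else 0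
  have hdet : M.det = 1 := by
    rw [Matrix.det_of_isLowerTriangular M fun i j hij => if_neg (not_le.2 hij)]
    simp [M]
  have hM : (Matrix.toLin' M : (Fin n → ℝ) → Fin n → ℝ) =
      fun s i => ∑ j ∈ Finset.Iic i, s j := by
    ext s i
    rw [Matrix.toLin'_apply, ← Finset.filter_ge_eq_Iic, Finset.sum_filter]
    simp [Matrix.mulVec, dotProduct, M]
  rw [← hM]
  refine ⟨(LinearMap.continuous_of_finiteDimensional _).measurable, ?_⟩
  rw [Real.map_matrix_volume_pi_eq_smul_volume_pi (by simp [hdet]), hdet]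
  simp

theorem sum_Iic_sub_sum_Iic {n : ℕ} (s : Fin n → ℝ) {i j : Fin n} (hij : i ≤ j) :
    ∑ k ∈ Finset.Iic j, s k - ∑ k ∈ Finset.Iic i, s k = ∑ k ∈ Finset.Ioc i j, s k := by
  rw [sub_eq_iff_eq_add, ← Finset.sum_union]
  · congr 1
    ext k
    simp only [Finset.mem_union, Finset.mem_Ioc, Finset.mem_Iic]
    grind
  · rw [Finset.disjoint_left]
    grind

theorem strictMono_partialSums_iff {n : ℕ} (hn : n ≠ 0) (s : Fin n → ℝ) :
    (StrictMono (fun i => ∑ j ∈ Finset.Iic i, s j) ∧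
      ∀ i, ∑ j ∈ Finset.Iic i, s j ∈ Ioc (0 : ℝ) 1) ↔ (∀ i, 0 < s i) ∧ ∑ i, s i ≤ 1 := by
  obtain ⟨n, rfl⟩ := Nat.exists_eq_succ_of_ne_zero hn
  constructor
  · rintro ⟨hmono, hmem⟩
    refine ⟨fun i => ?_, ?_⟩
    · cases i using Fin.cases with
      | zero => simpa [show Finset.Iic (0 : Fin (n + 1)) = {0} from Finset.Iic_bot] using (hmem 0).1
      | succ i =>
        have h := sub_pos.2 (hmono i.castSucc_lt_succ)
        have hIoc : Finset.Ioc i.castSucc i.succ = {i.succ} := by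
          ext k
          simp only [Finset.mem_Ioc, Finset.mem_singleton, Fin.lt_def, Fin.le_def, Fin.ext_iff,
            Fin.val_castSucc, Fin.val_succ]
          omega
        rwa [sum_Iic_sub_sum_Iic s i.castSucc_lt_succ.le, hIoc, Finset.sum_singleton] at h
    · simpa [show Finset.Iic (Fin.last n) = Finset.univ from Finset.Iic_top] using
        (hmem (Fin.last n)).2
  · rintro ⟨hpos, hsum⟩
    refine ⟨fun i j hij => ?_, fun i => ⟨?_, ?_⟩⟩
    · rw [← sub_pos, sum_Iic_sub_sum_Iic s hij.le]
      exact Finset.sum_pos (fun k _ => hpos k) ⟨j, by simp [hij]⟩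
    · exact Finset.sum_pos (fun k _ => hpos k) ⟨i, by simp⟩
    · exact (Finset.sum_le_univ_sum_of_nonneg fun k => (hpos k).le).trans hsum

theorem lintegral_unifPi_indicator_strictMono {n : ℕ} (hn : n ≠ 0) {h : (Fin n → ℝ) → ℝ≥0∞}
    (hh : Measurable h) :
    ∫⁻ ω, {x : Fin n → ℝ | StrictMono x}.indicator h ω ∂unifPi n =
      ∫⁻ s, (if ∑ i, s i ≤ 1 then h (fun i => ∑ j ∈ Finset.Iic i, s j) else 0)
        ∂(Measure.pi fun _ : Fin n => volume.restrict (Ioi (0 : ℝ))) := by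
  have hbox : MeasurableSet (univ.pi fun _ : Fin n => Ioc (0 : ℝ) 1) :=
    .univ_pi fun _ => measurableSet_Ioc
  have horth : MeasurableSet (univ.pi fun _ : Fin n => Ioi (0 : ℝ)) :=
    .univ_pi fun _ => measurableSet_Ioi
  rw [unifPi_eq_restrict, ← Measure.restrict_pi_pi, ← volume_pi, ← lintegral_indicator hbox,
    ← lintegral_indicator horth, ← (measurePreserving_partialSums n).lintegral_comp
      ((hh.indicator (measurableSet_strictMono n)).indicator hbox)]
  refine lintegral_congr fun s => ?_
  have := strictMono_partialSums_iff hn s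
  classical
  simp only [indicator_apply, mem_univ_pi, mem_ofPred_eq, mem_Ioi]
  grind

theorem lintegral_sortedTuple_sub_rpow {n : ℕ} {a b : Fin n} (hab : a < b) {γ : ℝ}
    (hγ : 0 < (b - a : ℝ) + γ) :
    ∫⁻ ω, ENNReal.ofReal ((sortedTuple ω b - sortedTuple ω a) ^ γ) ∂unifPi n =
      ENNReal.ofReal (Real.Gamma (n + 1) * Real.Gamma (b - a + γ) /
        (Real.Gamma (b - a) * Real.Gamma (n + γ + 1))) := by
  obtain ⟨k, hk⟩ : ∃ k : ℕ, (b : ℕ) = a + (k + 1) := ⟨b - a - 1, by omega⟩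
  obtain ⟨m, hm⟩ : ∃ m : ℕ, n = (k + 1) + (m + 1) := ⟨n - k - 2, by omega⟩
  let p : Fin n → Prop := fun i => a < i ∧ i ≤ b
  have hp : Finset.univ.filter p = Finset.Ioc a b := by
    ext i
    simp [p]
  have hcard : Fintype.card {i // p i} = k + 1 := by
    rw [Fintype.card_subtype, hp, Fin.card_Ioc]
    omega
  have hcard' : Fintype.card {i // ¬ p i} = m + 1 := by
    rw [Fintype.card_subtype_compl, hcard, Fintype.card_fin]
    omega
  let H : ℝ → ℝ → ℝ≥0∞ := fun x y => if x + y ≤ 1 then ENNReal.ofReal (x ^ γ) else 0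
  have hH : Measurable (Function.uncurry H) :=
    Measurable.ite (measurableSet_le (by fun_prop) (by fun_prop)) (by fun_prop) (by fun_prop)
  have hba : (b : ℝ) - a = k + 1 := by rw [hk]; push_cast; ring
  have hn : (n : ℝ) = k + m + 2 := by rw [hm]; push_cast; ring
  rw [hba] at hγ ⊢
  rw [lintegral_sortedTuple (h := fun x => ENNReal.ofReal ((x b - x a) ^ γ)) (by fun_prop),
    lintegral_unifPi_indicator_strictMono (by omega) (by fun_prop)]
  have hsum (s : Fin n → ℝ) :
      (if ∑ i, s i ≤ 1 then ENNReal.ofReal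
        ((∑ j ∈ Finset.Iic b, s j - ∑ j ∈ Finset.Iic a, s j) ^ γ) else 0) =
      H (∑ i : {i // p i}, s i) (∑ i : {i // ¬ p i}, s i) := by
    simp only [H]
    rw [Fintype.sum_subtype_add_sum_subtype p s, sum_Iic_sub_sum_Iic s hab.le, ← hp,
      Finset.sum_subtype (p := p) (Finset.univ.filter p) (by simp)]
  simp_rw [hsum]
  rw [lintegral_pi_Ioi_sum_subtype p hcard hcard' hH, lintegral_simplex_rpow_sum k m hγ,
    ← ENNReal.ofReal_natCast, ← ENNReal.ofReal_mul (by positivity), ← Real.Gamma_nat_eq_factorial,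
    hn, mul_div_assoc]

theorem integral_sortedTuple_sub_rpow {n : ℕ} {a b : Fin n} (hab : a < b) {γ : ℝ}
    (hγ : 0 < (b - a : ℝ) + γ) :
    ∫ ω, (sortedTuple ω b - sortedTuple ω a) ^ γ ∂unifPi n =
      Real.Gamma (n + 1) * Real.Gamma (b - a + γ) /
        (Real.Gamma (b - a) * Real.Gamma (n + γ + 1)) := by
  have hba : (0 : ℝ) < b - a := by simpa using hab
  have hbn : (b : ℝ) < n := by exact_mod_cast b.2
  have ha : (0 : ℝ) ≤ a := by positivity
  rw [integral_eq_lintegral_of_nonneg_ae, lintegral_sortedTuple_sub_rpow hab hγ,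
    ENNReal.toReal_ofReal]
  · have := Real.Gamma_pos_of_pos hγ
    have := Real.Gamma_pos_of_pos hba
    have := Real.Gamma_pos_of_pos (show (0 : ℝ) < n + γ + 1 by linarith)
    have := Real.Gamma_pos_of_pos (show (0 : ℝ) < n + 1 by linarith)
    positivity
  · exact .of_forall fun ω =>
      Real.rpow_nonneg (sub_nonneg.2 (Tuple.monotone_sort ω hab.le)) γ
  · exact (aemeasurable_apply_sortedTuple (h := fun x => (x b - x a) ^ γ)
      (by fun_prop)).aestronglyMeasurable

/-- For a uniform sample of `2N` points, `N + γ > 0` and `1 ≤ l ≤ N`,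
`E[(X₍l+N₎ − X₍l₎)^γ] = Γ(2N+1)Γ(N+γ)/(Γ(N)Γ(2N+γ+1))`. -/
theorem crossing_length_power_moment {N : ℕ} (hN : 0 < N) (γ : ℝ)
    (hγ : 0 < (N : ℝ) + γ) (l : Fin N) :
    ∫ ω : Fin (2 * N) → ℝ,
        (sortedTuple ω ⟨l.1 + N, by omega⟩ - sortedTuple ω ⟨l.1, by omega⟩) ^ γ
      ∂(unifPi (2 * N)) =
      Real.Gamma (2 * N + 1) * Real.Gamma (N + γ) /
        (Real.Gamma N * Real.Gamma (2 * N + γ + 1)) := by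
  have h := integral_sortedTuple_sub_rpow (n := 2 * N) (a := ⟨l.1, by omega⟩)
    (b := ⟨l.1 + N, by omega⟩) (γ := γ) (by simpa using hN) (by simpa using hγ)
  simpa using h
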